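/- Let n ≥ 1 be an integer, α > −1 a real number, and ξ ∈ ℕ₀. Then the star-subalgebra of M_n(ℂ) (with conjugate-transpose as star) generated over ℂ by the n matrices γ(g_{n−1+ξ})_ξ, γ(g_{n+ξ})_ξ, …, γ(g_{2n−2+ξ})_ξ is all of M_n(ℂ). -/

import Mathlib

open MeasureTheory Filter
open scoped ENNReal

noncomputable section

/-- Generalized binomial coefficient `x(x-1)⋯(x-j+1)/j!`. -/
def gbinom (x : ℝ) (j : ℕ) : ℝ :=
  (∏ i ∈ Finset.range j, (x - i)) / (Nat.factorial j)

/-- Shifted Jacobi polynomial `Q_m^{(α,β)}` on `[0,1]`: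
`Q_m^{(α,β)}(t) = Σ_{k=0}^m binom(α+β+m+k,k)·binom(β+m,m-k)·(-1)^{m-k}·t^k`. -/
def jacQ (α β : ℝ) (m : ℕ) (t : ℝ) : ℝ :=
  ∑ k ∈ Finset.range (m + 1),
    gbinom (α + β + m + k) k * gbinom (β + m) (m - k) * (-1 : ℝ) ^ (m - k) * t ^ k

/-- Normalizing coefficient
`κ(α,β,m) = sqrt((2m+α+β+1)·Γ(m+α+β+1)·m!/(Γ(m+α+1)·Γ(m+β+1)))`. -/
def jacCoef (α β : ℝ) (m : ℕ) : ℝ :=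
  Real.sqrt ((2 * m + α + β + 1) * Real.Gamma (m + α + β + 1) * (Nat.factorial m) /
    (Real.Gamma (m + α + 1) * Real.Gamma (m + β + 1)))

/-- Jacobi function `J_m^{(α,β)}(t) = κ(α,β,m)·(1-t)^{α/2}·t^{β/2}·Q_m^{(α,β)}(t)`. -/
def jacJ (α β : ℝ) (m : ℕ) (t : ℝ) : ℝ :=
  jacCoef α β m * (1 - t) ^ (α / 2) * t ^ (β / 2) * jacQ α β m t

/-- `dd n ξ = min(n+ξ, n)` (for `ξ ≥ 1-n`), written as a total function into `ℕ`. -/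
def dd (n : ℕ) (ξ : ℤ) : ℕ := n - (-ξ).toNat

lemma dd_le (n : ℕ) (ξ : ℤ) : dd n ξ ≤ n := Nat.sub_le _ _

/-- The set `Ω_n = {ξ ∈ ℤ : ξ ≥ -n+1}` as a subtype. -/
abbrev Om (n : ℕ) : Type := {ξ : ℤ // 1 - (n : ℤ) ≤ ξ}

/-- The entry `γ(a)_{ξ,j,k} = κ(α,|ξ|,j)·κ(α,|ξ|,k)·
∫₀¹ a(√t)·Q_j^{(α,|ξ|)}(t)·Q_k^{(α,|ξ|)}(t)·(1-t)^α·t^{|ξ|} dt`. -/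
def gammaEnt (α : ℝ) (a : ℝ → ℂ) (ξ : ℤ) (j k : ℕ) : ℂ :=
  ((jacCoef α ξ.natAbs j * jacCoef α ξ.natAbs k : ℝ) : ℂ) *
    ∫ t in (0:ℝ)..1, a (Real.sqrt t) *
      ((jacQ α ξ.natAbs j t * jacQ α ξ.natAbs k t * (1 - t) ^ α * t ^ (ξ.natAbs) : ℝ) : ℂ)

/-- The matrix `γ(a)_ξ ∈ M_{d_ξ}(ℂ)`. -/
def gammaMat (n : ℕ) (α : ℝ) (a : ℝ → ℂ) (ξ : ℤ) :
    Matrix (Fin (dd n ξ)) (Fin (dd n ξ)) ℂ :=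
  Matrix.of fun j k => gammaEnt α a ξ (j : ℕ) (k : ℕ)

/-- Bounded measurable functions on `[0,1)` having a finite limit at `1⁻`. -/
def LinfLim (a : ℝ → ℂ) : Prop :=
  Measurable a ∧ (∃ C : ℝ, ∀ r ∈ Set.Ico (0:ℝ) 1, ‖a r‖ ≤ C) ∧
    ∃ ω : ℂ, Tendsto a (nhdsWithin 1 (Set.Ico (0:ℝ) 1)) (nhds ω)

/-- The generating symbol `g_p(t) = Q_p^{(α,0)}(t²)`, as a complex-valued function. -/
def gSym (α : ℝ) (p : ℕ) (t : ℝ) : ℂ := ((jacQ α 0 p (t ^ 2) : ℝ) : ℂ)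

/-- `⟨A w, w⟩ = Σ_{j,k} conj(w_j)·A_{j,k}·w_k`. -/
def innerForm {d : ℕ} (A : Matrix (Fin d) (Fin d) ℂ) (w : Fin d → ℂ) : ℂ :=
  ∑ j : Fin d, ∑ k : Fin d, (starRingEnd ℂ) (w j) * A j k * w k

open Polynomial in
/-- The shifted Jacobi polynomial as an element of `ℝ[X]`. -/
def jacPoly (α β : ℝ) (m : ℕ) : ℝ[X] :=
  ∑ k ∈ Finset.range (m + 1),
    C (gbinom (α + β + m + k) k * gbinom (β + m) (m - k) * (-1 : ℝ) ^ (m - k)) * X ^ k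

lemma jacPoly_eval (α β : ℝ) (m : ℕ) (t : ℝ) : (jacPoly α β m).eval t = jacQ α β m t := by
  simp [jacPoly, jacQ, Polynomial.eval_finsetSum]

lemma jacPoly_natDegree_le (α β : ℝ) (m : ℕ) : (jacPoly α β m).natDegree ≤ m := by
  refine Polynomial.natDegree_sum_le_of_forall_le _ _ fun k hk => ?_
  exact (Polynomial.natDegree_C_mul_X_pow_le _ _).trans (Nat.lt_succ_iff.mp (Finset.mem_range.mp hk))

lemma gbinom_pos {x : ℝ} {j : ℕ} (h : (j : ℝ) - 1 < x) : 0 < gbinom x j := by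
  refine div_pos (Finset.prod_pos fun i hi => ?_) (by positivity)
  have : (i : ℝ) + 1 ≤ j := by exact_mod_cast Finset.mem_range.mp hi
  linarith

lemma jacPoly_coeff_pos {α β : ℝ} (hα : -1 < α) (hβ : 0 ≤ β) (m : ℕ) :
    0 < (jacPoly α β m).coeff m := by
  have : (jacPoly α β m).coeff m = gbinom (α + β + m + m) m := by
    simp only [jacPoly, Polynomial.finsetSum_coeff, Polynomial.coeff_C_mul, Polynomial.coeff_X_pow]
    simp [gbinom]
  rw [this]
  refine gbinom_pos ?_
  have : (0 : ℝ) ≤ m := m.cast_nonneg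
  linarith

lemma jacPoly_natDegree {α β : ℝ} (hα : -1 < α) (hβ : 0 ≤ β) (m : ℕ) :
    (jacPoly α β m).natDegree = m :=
  (jacPoly_natDegree_le α β m).antisymm
    (Polynomial.le_natDegree_of_ne_zero (jacPoly_coeff_pos hα hβ m).ne')

lemma jacPoly_ne_zero {α β : ℝ} (hα : -1 < α) (hβ : 0 ≤ β) (m : ℕ) : jacPoly α β m ≠ 0 := by
  intro h
  simpa [h] using jacPoly_coeff_pos hα hβ m

lemma intervalIntegrable_polynomial_mul_rpow {α : ℝ} (hα : -1 < α) (p : Polynomial ℝ) :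
    IntervalIntegrable (fun t => p.eval t * (1 - t) ^ α) volume 0 1 := by
  have h : IntervalIntegrable (fun t : ℝ => (1 - t) ^ α) volume 0 1 := by
    simpa using
      ((intervalIntegral.intervalIntegrable_rpow' hα (a := 0) (b := 1)).comp_sub_left 1).symm
  exact h.continuousOn_mul p.continuous.continuousOn

/-- Integration over `[0,1]` against the weight `(1-t)^α`, on polynomials. -/
def weightFunctional {α : ℝ} (hα : -1 < α) : Polynomial ℝ →ₗ[ℝ] ℝ where
  toFun p := ∫ t in (0:ℝ)..1, p.eval t * (1 - t) ^ α
  map_add' p q := by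
    rw [← intervalIntegral.integral_add (intervalIntegrable_polynomial_mul_rpow hα p)
      (intervalIntegrable_polynomial_mul_rpow hα q)]
    simp [add_mul]
  map_smul' c p := by
    simp [mul_assoc]

lemma weightFunctional_apply {α : ℝ} (hα : -1 < α) (p : Polynomial ℝ) :
    weightFunctional hα p = ∫ t in (0:ℝ)..1, p.eval t * (1 - t) ^ α := rfl

open Polynomial in
lemma weightFunctional_X_pow {α : ℝ} (hα : -1 < α) (m : ℕ) :
    weightFunctional hα (X ^ m) =
      Real.Gamma (m + 1) * Real.Gamma (α + 1) / Real.Gamma (m + 1 + (α + 1)) := by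
  have h := ProbabilityTheory.beta_eq_betaIntegralReal (m + 1) (α + 1) (by positivity) (by linarith)
  rw [ProbabilityTheory.beta, Complex.betaIntegral] at h
  rw [h, weightFunctional_apply, ← Complex.ofReal_re (∫ t in (0:ℝ)..1, _),
    ← intervalIntegral.integral_ofReal]
  congr 1
  refine intervalIntegral.integral_congr fun t ht => ?_
  rw [Set.uIcc_of_le zero_le_one] at ht
  have h1 : 0 ≤ 1 - t := by linarith [ht.2]
  simp [Complex.ofReal_cpow h1]

lemma weightFunctional_mul_self_pos {α : ℝ} (hα : -1 < α) {p : Polynomial ℝ} (hp : p ≠ 0) :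
    0 < weightFunctional hα (p * p) := by
  have hnn : ∀ t ∈ Set.Ioc (0:ℝ) 1, 0 ≤ (p * p).eval t * (1 - t) ^ α := fun t ht => by
    rw [Polynomial.eval_mul]
    exact mul_nonneg (mul_self_nonneg _) (Real.rpow_nonneg (by linarith [ht.2]) _)
  rw [weightFunctional_apply, intervalIntegral.integral_pos_iff_support_of_nonneg_ae'
    _ (intervalIntegrable_polynomial_mul_rpow hα _)]
  · refine ⟨zero_lt_one, ?_⟩
    have hsub : Set.Ioo (0:ℝ) 1 \ p.roots.toFinset ⊆
        Function.support (fun t => (p * p).eval t * (1 - t) ^ α) ∩ Set.Ioc 0 1 := by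
      rintro t ⟨ht, hr⟩
      refine ⟨?_, Set.Ioo_subset_Ioc_self ht⟩
      have h0 : p.eval t ≠ 0 := by simpa [hp] using hr
      have h1 : (0:ℝ) < (1 - t) ^ α := Real.rpow_pos_of_pos (by linarith [ht.2]) _
      simp [h0, h1.ne']
    refine lt_of_lt_of_le ?_ (measure_mono hsub)
    rw [measure_sdiff_null ((Finset.finite_toSet _).measure_zero _)]
    simp
  · rw [Set.uIoc_of_le zero_le_one]
    exact (ae_restrict_iff' measurableSet_Ioc).mpr (Eventually.of_forall hnn)

lemma Gamma_add_natCast {x : ℝ} (hx : 0 < x) (n : ℕ) :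
    Real.Gamma (x + n) = (∏ i ∈ Finset.range n, (x + i)) * Real.Gamma x := by
  induction n with
  | zero => simp
  | succ n ih =>
    have : x + n ≠ 0 := by positivity
    rw [Nat.cast_succ, ← add_assoc, Real.Gamma_add_one this, ih, Finset.prod_range_succ]
    ring

lemma gbinom_add_natCast {x : ℝ} (hx : 0 < x + 1) (k : ℕ) :
    gbinom (x + k) k = Real.Gamma (x + 1 + k) / (k.factorial * Real.Gamma (x + 1)) := by
  have hG := (Real.Gamma_pos_of_pos hx).ne'
  rw [Gamma_add_natCast hx, mul_div_mul_right _ _ hG, gbinom,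
    ← Finset.prod_range_reflect (fun i : ℕ => x + 1 + (i : ℝ))]
  congr 1
  refine Finset.prod_congr rfl fun i hi => ?_
  have hi := Finset.mem_range.mp hi
  rw [Nat.cast_sub (by omega), Nat.cast_sub (by omega)]
  push_cast
  ring

lemma gbinom_natCast {n j : ℕ} (h : j ≤ n) : gbinom n j = n.choose j := by
  rw [Nat.choose_eq_descFactorial_div_factorial,
    Nat.cast_div (Nat.factorial_dvd_descFactorial n j) (by positivity),
    Nat.descFactorial_eq_prod_range, gbinom]
  congr 1
  push_cast
  refine Finset.prod_congr rfl fun i hi => ?_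
  rw [Nat.cast_sub ((Finset.mem_range.mp hi).le.trans h)]

open Polynomial in
lemma weightFunctional_jacPoly_mul_X_pow {α : ℝ} (hα : -1 < α) {p s : ℕ} (hs : s < p) :
    weightFunctional hα (jacPoly α 0 p * X ^ s) = 0 := by
  obtain ⟨r, rfl⟩ := Nat.exists_eq_add_of_lt hs
  let P : ℝ[X] := (∏ i ∈ Finset.range s, (X + C (1 + i : ℝ))) *
    ∏ i ∈ Finset.range r, (X + C (s + α + 2 + i : ℝ))
  have hP : P.natDegree < s + r + 1 := by
    refine Nat.lt_succ_of_le (natDegree_mul_le.trans (add_le_add ?_ ?_))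
    all_goals
      refine (natDegree_prod_le _ _).trans ((Finset.sum_le_card_nsmul _ _ 1 fun i _ => ?_).trans ?_)
      · exact (natDegree_X_add_C _).le
      · simp
  have hfd := congrFun (Polynomial.fwdDiff_iter_eq_zero_of_degree_lt hP) 0
  rw [fwdDiff_iter_eq_sum_shift] at hfd
  have hterm : ∀ k ∈ Finset.range (s + r + 1 + 1),
      weightFunctional hα (C (gbinom (α + 0 + (s + r + 1 : ℕ) + k) k *
        gbinom (0 + (s + r + 1 : ℕ)) (s + r + 1 - k) * (-1 : ℝ) ^ (s + r + 1 - k)) * X ^ k * X ^ s) =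
      Real.Gamma (α + 1) / Real.Gamma (α + (s + r + 1 : ℕ) + 1) *
      (((-1 : ℤ) ^ (s + r + 1 - k) * (s + r + 1).choose k) • P.eval (0 + k • (1 : ℝ))) := by
    intro k hk
    have hk := Nat.lt_succ_iff.mp (Finset.mem_range.mp hk)
    have hk0 : (0 : ℝ) ≤ k := k.cast_nonneg
    have hs0 : (0 : ℝ) ≤ s := s.cast_nonneg
    have hr0 : (0 : ℝ) ≤ r := r.cast_nonneg
    rw [mul_assoc, ← pow_add, ← smul_eq_C_mul, map_smul, weightFunctional_X_pow, add_zero, zero_add,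
      gbinom_natCast (Nat.sub_le _ _), Nat.choose_symm hk,
      gbinom_add_natCast (by push_cast; linarith)]
    have h1 : Real.Gamma ((k + s : ℕ) + 1) =
        (∏ i ∈ Finset.range s, ((k : ℝ) + (1 + i))) * k.factorial := by
      have := Gamma_add_natCast (x := (k : ℝ) + 1) (by linarith) s
      rw [Real.Gamma_nat_eq_factorial] at this
      simp only [← add_assoc]
      rw [← this]
      congr 1
      push_cast
      ring
    have h2 : Real.Gamma (α + (s + r + 1 : ℕ) + 1 + k) =
        (∏ i ∈ Finset.range r, ((k : ℝ) + (s + α + 2 + i))) *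
          Real.Gamma ((k + s : ℕ) + 1 + (α + 1)) := by
      have := Gamma_add_natCast (x := ((k + s : ℕ) : ℝ) + 1 + (α + 1)) (by push_cast; linarith) r
      rw [show α + (s + r + 1 : ℕ) + 1 + (k : ℝ) = ((k + s : ℕ) : ℝ) + 1 + (α + 1) + r by
        push_cast; ring, this]
      congr 1
      refine Finset.prod_congr rfl fun i _ => ?_
      push_cast
      ring
    have h3 : Real.Gamma ((k + s : ℕ) + 1 + (α + 1)) ≠ 0 :=
      (Real.Gamma_pos_of_pos (by push_cast; linarith)).ne'
    have h4 : Real.Gamma (α + (s + r + 1 : ℕ) + 1) ≠ 0 :=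
      (Real.Gamma_pos_of_pos (by push_cast; linarith)).ne'
    have h5 : (k.factorial : ℝ) ≠ 0 := by positivity
    rw [h1, h2]
    simp only [P, eval_mul, eval_prod, eval_add, eval_X, eval_C, zsmul_eq_mul, smul_eq_mul,
      nsmul_eq_mul, mul_one, zero_add]
    push_cast at h3 h4 ⊢
    field_simp
  rw [jacPoly, Finset.sum_mul, map_sum, Finset.sum_congr rfl hterm, ← Finset.mul_sum, hfd]
  simp

open Polynomial in
lemma weightFunctional_jacPoly_mul_of_degree_lt {α : ℝ} (hα : -1 < α) {p : ℕ} {r : ℝ[X]}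
    (hr : r.degree < p) : weightFunctional hα (jacPoly α 0 p * r) = 0 := by
  rcases eq_or_ne r 0 with rfl | h0
  · simp
  have hr' := (natDegree_lt_iff_degree_lt h0).mpr hr
  rw [r.as_sum_range_C_mul_X_pow, Finset.mul_sum, map_sum]
  refine Finset.sum_eq_zero fun s hs => ?_
  have hs := Finset.mem_range.mp hs
  rw [mul_left_comm, ← smul_eq_C_mul, map_smul,
    weightFunctional_jacPoly_mul_X_pow hα (by omega), smul_zero]

open Polynomial in
lemma weightFunctional_jacPoly_mul_ne_zero {α : ℝ} (hα : -1 < α) {r : ℝ[X]} (h0 : r ≠ 0) :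
    weightFunctional hα (jacPoly α 0 r.natDegree * r) ≠ 0 := by
  set J := jacPoly α 0 r.natDegree with hJ
  have hJ0 : J ≠ 0 := jacPoly_ne_zero hα le_rfl _
  have hJd : J.natDegree = r.natDegree := jacPoly_natDegree hα le_rfl _
  have hlc : J.leadingCoeff ≠ 0 := leadingCoeff_ne_zero.mpr hJ0
  have hrc : r.leadingCoeff ≠ 0 := leadingCoeff_ne_zero.mpr h0
  set c := r.leadingCoeff / J.leadingCoeff with hc
  have hc0 : c ≠ 0 := div_ne_zero hrc hlc
  have hlt : (r - c • J).degree < r.natDegree := by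
    rw [← degree_eq_natDegree h0]
    refine degree_sub_lt_left ?_ h0 ?_
    · rw [degree_smul_of_smul_regular _ (IsSMulRegular.of_ne_zero hc0), degree_eq_natDegree h0,
        degree_eq_natDegree hJ0, hJd]
    · rw [smul_eq_C_mul, leadingCoeff_mul, leadingCoeff_C, hc, div_mul_cancel₀ _ hlc]
  have h := weightFunctional_jacPoly_mul_of_degree_lt hα hlt
  rw [← hJ, mul_sub, map_sub, mul_smul_comm, map_smul, sub_eq_zero] at h
  rw [h]
  exact smul_ne_zero hc0 (weightFunctional_mul_self_pos hα hJ0).ne'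

lemma jacCoef_pos {α β : ℝ} (hα : -1 < α) (hβ : 0 ≤ β) {m : ℕ} : 0 < jacCoef α β m := by
  have hm : (0 : ℝ) ≤ m := m.cast_nonneg
  have h1 : 0 < 2 * m + α + β + 1 := by linarith
  have h2 := Real.Gamma_pos_of_pos (show 0 < m + α + β + 1 by linarith)
  have h3 := Real.Gamma_pos_of_pos (show 0 < m + α + 1 by linarith)
  have h4 := Real.Gamma_pos_of_pos (show 0 < m + β + 1 by linarith)
  exact Real.sqrt_pos.mpr (by positivity)

open Polynomial in
lemma gammaEnt_gSym {α : ℝ} (hα : -1 < α) (p ξ j k : ℕ) :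
    gammaEnt α (gSym α p) ξ j k = ((jacCoef α ξ j * jacCoef α ξ k *
      weightFunctional hα (jacPoly α 0 p * (jacPoly α ξ j * jacPoly α ξ k * X ^ ξ)) : ℝ) : ℂ) := by
  rw [gammaEnt, Int.natAbs_natCast, Complex.ofReal_mul (_ * _) (weightFunctional hα _),
    weightFunctional_apply, ← intervalIntegral.integral_ofReal]
  congr 1
  refine intervalIntegral.integral_congr fun t ht => ?_
  rw [Set.uIcc_of_le zero_le_one] at ht
  simp only [gSym, Real.sq_sqrt ht.1, eval_mul, jacPoly_eval, eval_pow, eval_X]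
  push_cast
  ring

open Polynomial in
lemma jacPoly_mul_jacPoly_mul_X_pow_natDegree {α : ℝ} (hα : -1 < α) (ξ j k : ℕ) :
    (jacPoly α ξ j * jacPoly α ξ k * X ^ ξ).natDegree = j + k + ξ := by
  have h : ∀ m, jacPoly α ξ m ≠ 0 := jacPoly_ne_zero hα ξ.cast_nonneg
  rw [natDegree_mul_X_pow _ (mul_ne_zero (h j) (h k)), natDegree_mul (h j) (h k),
    jacPoly_natDegree hα ξ.cast_nonneg, jacPoly_natDegree hα ξ.cast_nonneg]

open Polynomial in
lemma gammaEnt_gSym_eq_zero {α : ℝ} (hα : -1 < α) {p ξ j k : ℕ} (h : j + k + ξ < p) :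
    gammaEnt α (gSym α p) ξ j k = 0 := by
  rw [gammaEnt_gSym hα, weightFunctional_jacPoly_mul_of_degree_lt hα, mul_zero, Complex.ofReal_zero]
  refine degree_le_natDegree.trans_lt ?_
  rw [jacPoly_mul_jacPoly_mul_X_pow_natDegree hα]
  exact_mod_cast h

open Polynomial in
lemma gammaEnt_gSym_ne_zero {α : ℝ} (hα : -1 < α) {p ξ j k : ℕ} (h : j + k + ξ = p) :
    gammaEnt α (gSym α p) ξ j k ≠ 0 := by
  have h0 : ∀ m, jacPoly α ξ m ≠ 0 := jacPoly_ne_zero hα ξ.cast_nonneg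
  rw [gammaEnt_gSym hα, ← h, ← jacPoly_mul_jacPoly_mul_X_pow_natDegree hα ξ j k,
    Complex.ofReal_ne_zero]
  exact mul_ne_zero (mul_pos (jacCoef_pos hα ξ.cast_nonneg) (jacCoef_pos hα ξ.cast_nonneg)).ne'
    (weightFunctional_jacPoly_mul_ne_zero hα
      (mul_ne_zero (mul_ne_zero (h0 j) (h0 k)) (pow_ne_zero _ X_ne_zero)))

/-- A star-subalgebra of `M_d(ℂ)` is everything if it contains, for each `q < d`, a matrix whose
`(j,k)` entry vanishes for `j + k < d - 1 + q` and is nonzero for `j + k = d - 1 + q`. -/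
lemma StarSubalgebra.eq_top_of_antitriangular {d : ℕ} (hd : 1 ≤ d)
    (S : StarSubalgebra ℂ (Matrix (Fin d) (Fin d) ℂ)) (A : ℕ → Matrix (Fin d) (Fin d) ℂ)
    (hA : ∀ q < d, A q ∈ S)
    (hzero : ∀ q (j k : Fin d), (j : ℕ) + k < d - 1 + q → A q j k = 0)
    (hne : ∀ q (j k : Fin d), (j : ℕ) + k = d - 1 + q → A q j k ≠ 0) : S = ⊤ := by
  let l : Fin d := ⟨d - 1, by omega⟩
  have hl : Matrix.single l l (1 : ℂ) ∈ S := by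
    have hc : A (d - 1) l l ≠ 0 := hne _ _ _ (by simp [l])
    have : Matrix.single l l (1 : ℂ) = (A (d - 1) l l)⁻¹ • A (d - 1) := by
      ext j k
      rw [Matrix.smul_apply, smul_eq_mul, Matrix.single_apply]
      split_ifs with h
      · rw [← h.1, ← h.2, inv_mul_cancel₀ hc]
      · rw [hzero (d - 1) j k, mul_zero]
        by_contra hjk
        refine h ⟨Fin.ext ?_, Fin.ext ?_⟩ <;> simp only [l] <;> omega
    rw [this]
    exact S.smul_mem (hA _ (by omega)) _
  have hcol : ∀ m, ∀ j : Fin d, d - 1 - (j : ℕ) = m → Matrix.single j l (1 : ℂ) ∈ S := by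
    intro m
    induction m using Nat.strong_induction_on with
    | _ m ih =>
      rintro j rfl
      have hc : A j j l ≠ 0 := hne _ _ _ (by simp only [l]; omega)
      have hexp : A j * Matrix.single l l 1 = ∑ i, A j i l • Matrix.single i l (1 : ℂ) := by
        ext a b
        rcases eq_or_ne b l with rfl | hb
        · simp [Matrix.sum_apply, Matrix.single_apply]
        · simp [Matrix.sum_apply, hb, hb.symm]
      have hmem : A j * Matrix.single l l 1 ∈ S := S.mul_mem (hA _ j.2) hl
      rw [hexp, ← Finset.add_sum_erase _ _ (Finset.mem_univ j)] at hmem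
      have hrest : ∑ i ∈ Finset.univ.erase j, A j i l • Matrix.single i l (1 : ℂ) ∈ S := by
        refine sum_mem fun i hi => ?_
        have hij : (i : ℕ) ≠ j := fun h => Finset.ne_of_mem_erase hi (Fin.ext h)
        rcases lt_or_gt_of_ne hij with h | h
        · rw [hzero _ _ _ (by simp only [l]; omega), zero_smul]
          exact S.zero_mem
        · exact S.smul_mem (ih _ (by omega) i rfl) _
      have := S.smul_mem ((add_mem_cancel_right hrest).mp hmem) (A j j l)⁻¹
      rwa [smul_smul, inv_mul_cancel₀ hc, one_smul] at this
  have hunit : ∀ i j, Matrix.single i j (1 : ℂ) ∈ S := fun i j => by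
    have h := mul_mem (hcol _ i rfl) (star_mem (hcol _ j rfl))
    simpa [Matrix.star_eq_conjTranspose] using h
  refine StarSubalgebra.eq_top_iff.mpr fun M => ?_
  rw [Matrix.matrix_eq_sum_single M]
  refine sum_mem fun i _ => sum_mem fun j _ => ?_
  simpa using S.smul_mem (hunit i j) (M i j)

/-- for `ξ ∈ ℕ₀`, the matrices `γ(g_{n-1+ξ})_ξ, …, γ(g_{2n-2+ξ})_ξ`
generate the full matrix star-algebra `M_n(ℂ) = M_{d_ξ}(ℂ)`. -/
theorem statement10 (n : ℕ) (hn : 1 ≤ n) (α : ℝ) (hα : -1 < α) (ξ : ℕ) :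
    StarAlgebra.adjoin ℂ
      {A : Matrix (Fin (dd n (ξ : ℤ))) (Fin (dd n (ξ : ℤ))) ℂ |
        ∃ q : Fin n, A = gammaMat n α (gSym α (n - 1 + ξ + (q : ℕ))) (ξ : ℤ)} = ⊤ := by
  have hd : dd n (ξ : ℤ) = n := by simp [dd]
  refine StarSubalgebra.eq_top_of_antitriangular (hd.symm ▸ hn) _
    (fun q => gammaMat n α (gSym α (n - 1 + ξ + q)) ξ) (fun q hq => ?_) (fun q j k h => ?_)
    (fun q j k h => ?_)
  · exact StarAlgebra.subset_adjoin ℂ _ ⟨⟨q, hd ▸ hq⟩, rfl⟩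
  · exact gammaEnt_gSym_eq_zero hα (by omega)
  · exact gammaEnt_gSym_ne_zero hα (by omega)
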